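/- Let Ω ⊆ ℝ^N be a bounded open set. For each n let (y_n, D_n, f_n) be an admissible deformation triple on Ω, and let (y, D, f) be an admissible deformation triple on Ω. Assume: y_n → y almost everywhere in Ω; x ↦ det(f_n x) converges weakly in L¹(Ω) to x ↦ det(f x); and for every ε > 0 there is δ > 0 such that for all n and every measurable S ⊆ ℝ^N with volume(S) < δ one has volume(D_n ∩ y_n⁻¹(S)) < ε. Let v_n, v : ℝ^N → ℝ^M be Borel measurable maps such that the sequence of compositions (x ↦ v_n(y_n(x)))_n is equi-integrable on Ω and such that the indicator-extended Eulerian fields converge almost everywhere: χ_{y_n(D_n)}(ξ) v_n(ξ) → χ_{y(D)}(ξ) v(ξ) for almost every ξ ∈ ℝ^N. Then x ↦ v(y(x)) is integrable on Ω and ∫_Ω ‖v_n(y_n(x)) − v(y(x))‖ dx → 0 as n → ∞, i.e. v_n ∘ y_n → v ∘ y in L¹(Ω; ℝ^M). -/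

import Mathlib

open MeasureTheory Filter Topology Set
open scoped ENNReal NNReal

noncomputable section

abbrev Euc (N : ℕ) := EuclideanSpace ℝ (Fin N)

/-- An a.e. approximately differentiable map on `A`, encoded as a triple `(u, D, f)`. -/
def ApproxDiffTriple {N : ℕ} (A D : Set (Euc N)) (u : Euc N → Euc N)
    (f : Euc N → Euc N →L[ℝ] Euc N) : Prop :=
  MeasurableSet D ∧ D ⊆ A ∧ volume (A \ D) = 0 ∧ ∀ x ∈ D, HasFDerivWithinAt u (f x) D x

/-- An admissible deformation on `Ω` (the class `𝒴(Ω)` of the paper). -/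
def AdmissibleDef {N : ℕ} (Ω D : Set (Euc N)) (y : Euc N → Euc N)
    (f : Euc N → Euc N →L[ℝ] Euc N) : Prop :=
  ApproxDiffTriple Ω D y f ∧ Set.InjOn y D ∧ (∀ x ∈ D, 0 < (f x).det) ∧
    IntegrableOn (fun x => (f x).det) Ω volume

/-- Weak convergence in `L¹(Ω)`, tested against bounded measurable functions. -/
def WeakL1ConvOn {N : ℕ} (Ω : Set (Euc N)) (u : ℕ → Euc N → ℝ) (v : Euc N → ℝ) : Prop :=
  ∀ g : Euc N → ℝ, Measurable g → (∃ C : ℝ, ∀ x, |g x| ≤ C) →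
    Tendsto (fun n => ∫ x in Ω, u n x * g x) atTop (𝓝 (∫ x in Ω, v x * g x))

/-- A measurable function is close, outside a set of small finite measure, to a continuous one. -/
theorem exists_continuous_measure_edist_lt {X F : Type*} [TopologicalSpace X] [NormalSpace X]
    [MeasurableSpace X] [BorelSpace X] [NormedAddCommGroup F] [NormedSpace ℝ F]
    {ρ : Measure X} [IsFiniteMeasure ρ] [ρ.WeaklyRegular] {w : X → F} (hw : StronglyMeasurable w)
    {η δ : ℝ≥0∞} (hη : 0 < η) (hδ : 0 < δ) :
    ∃ g : X → F, Continuous g ∧ ρ {x | η ≤ edist (g x) (w x)} < δ := by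
  have hη2 : 0 < η / 2 := ENNReal.half_pos hη.ne'
  have hδ2 : 0 < δ / 2 := ENNReal.half_pos hδ.ne'
  have hmeas (k : ℕ) : MeasurableSet {x | ‖w x‖ ≤ k} :=
    measurableSet_le hw.norm.measurable measurable_const
  set wk : ℕ → X → F := fun k => {x | ‖w x‖ ≤ k}.indicator w with hwk
  have hwk_meas (k : ℕ) : StronglyMeasurable (wk k) := hw.indicator (hmeas k)
  have hwk_lim : TendstoInMeasure ρ wk atTop w := by
    refine tendstoInMeasure_of_tendsto_ae (fun k => (hwk_meas k).aestronglyMeasurable)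
      (ae_of_all _ fun x => tendsto_const_nhds.congr' ?_)
    obtain ⟨k₀, hk₀⟩ := exists_nat_ge ‖w x‖
    filter_upwards [eventually_ge_atTop k₀] with k hk
    exact (indicator_of_mem (s := {x | ‖w x‖ ≤ k}) (hk₀.trans (by exact_mod_cast hk)) w).symm
  obtain ⟨k, hk⟩ := ((hwk_lim _ hη2).eventually_lt_const hδ2).exists
  have hmem : MemLp (wk k) 1 ρ := by
    refine MemLp.of_bound (hwk_meas k).aestronglyMeasurable k (ae_of_all _ fun x => ?_)
    by_cases hx : ‖w x‖ ≤ k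
    · simp [hwk, hx]
    · simp [hwk, hx]
  choose g hg hg_mem using fun n : ℕ => hmem.exists_boundedContinuous_eLpNorm_sub_le
    ENNReal.one_ne_top (ε := ((n : ℝ≥0∞) + 1)⁻¹) (by simp)
  have hg_lim : TendstoInMeasure ρ (fun n => (g n : X → F)) atTop (wk k) := by
    refine tendstoInMeasure_of_tendsto_eLpNorm one_ne_zero (fun n => (hg_mem n).1) hmem.1 ?_
    refine tendsto_of_tendsto_of_tendsto_of_le_of_le tendsto_const_nhds
      ((tendsto_add_atTop_iff_nat 1).2 ENNReal.tendsto_inv_nat_nhds_zero) (fun _ => zero_le)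
      fun n => ?_
    rw [eLpNorm_sub_comm]
    simpa using hg n
  obtain ⟨n, hn⟩ := ((hg_lim _ hη2).eventually_lt_const hδ2).exists
  refine ⟨g n, (g n).continuous, ?_⟩
  calc ρ {x | η ≤ edist (g n x) (w x)}
      ≤ ρ ({x | η / 2 ≤ edist (g n x) (wk k x)} ∪ {x | η / 2 ≤ edist (wk k x) (w x)}) := by
        refine measure_mono fun x hx => ?_
        by_contra h
        simp only [mem_union, mem_ofPred_eq, not_or, not_le] at h hx
        exact absurd hx (not_le.2 ((edist_triangle _ (wk k x) _).trans_lt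
          ((ENNReal.add_lt_add h.1 h.2).trans_eq (ENNReal.add_halves η))))
    _ ≤ _ := measure_union_le _ _
    _ < δ / 2 + δ / 2 := ENNReal.add_lt_add hn hk
    _ = δ := ENNReal.add_halves δ

/-- If `y n → y₀` and `w n → w` almost everywhere and the images of `μ` under the maps `y n` are
uniformly absolutely continuous with respect to `ν`, then `w n ∘ y n → w ∘ y₀` in measure. -/
theorem tendstoInMeasure_comp_of_tendsto_ae {X E F : Type*} [MeasurableSpace X]
    [MetricSpace E] [ProperSpace E] [MeasurableSpace E] [BorelSpace E]
    [NormedAddCommGroup F] [NormedSpace ℝ F] [MeasurableSpace F] [BorelSpace F]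
    [SecondCountableTopology F]
    {μ : Measure X} [IsFiniteMeasure μ] {ν : Measure E} [IsFiniteMeasureOnCompacts ν]
    {y : ℕ → X → E} {y₀ : X → E} (hy : ∀ n, AEMeasurable (y n) μ)
    (hlim : ∀ᵐ x ∂μ, Tendsto (fun n => y n x) atTop (𝓝 (y₀ x)))
    (hac : ∀ ε : ℝ≥0∞, 0 < ε → ∃ δ : ℝ≥0∞, 0 < δ ∧ ∀ n, ∀ S : Set E,
      MeasurableSet S → ν S < δ → μ.map (y n) S < ε)
    {w : ℕ → E → F} {w₀ : E → F} (hw : ∀ n, Measurable (w n)) (hw₀ : Measurable w₀)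
    (hwlim : ∀ᵐ ξ ∂ν, Tendsto (fun n => w n ξ) atTop (𝓝 (w₀ ξ))) :
    TendstoInMeasure μ (fun n x => w n (y n x)) atTop (fun x => w₀ (y₀ x)) := by
  have hy₀ : AEMeasurable y₀ μ := aemeasurable_of_tendsto_metrizable_ae _ hy hlim
  intro η hη
  have hη4 : 0 < η / 4 := ENNReal.div_pos hη.ne' (by simp)
  have hylim : TendstoInMeasure μ y atTop y₀ :=
    tendstoInMeasure_of_tendsto_ae (fun n => (hy n).aestronglyMeasurable) hlim
  rw [ENNReal.tendsto_nhds_zero]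
  intro ε₀ hε₀
  obtain ⟨ε, hε, hεε₀⟩ : ∃ ε : ℝ≥0∞, 0 < ε ∧ 6 * ε ≤ ε₀ :=
    ⟨ε₀ / 6, ENNReal.div_pos hε₀.ne' (by simp), ENNReal.mul_div_le⟩
  obtain ⟨K, hK, hKε⟩ := isTightMeasureSet_iff_exists_isCompact_measure_compl_le.1
    (isTightMeasureSet_singleton (μ := μ.map y₀)) ε hε
  replace hKε : μ (y₀ ⁻¹' Kᶜ) ≤ ε := (Measure.le_map_apply hy₀ _).trans (hKε _ rfl)
  set B := Metric.cthickening 1 K with hB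
  have hBK : IsCompact B := hK.cthickening
  obtain ⟨δ, hδ, hδε⟩ := hac ε hε
  set ρ := ν.restrict B with hρ
  have : IsFiniteMeasure ρ := isFiniteMeasure_restrict.2 hBK.measure_lt_top.ne
  obtain ⟨g, hg, hgδ⟩ := exists_continuous_measure_edist_lt (ρ := ρ + μ.map y₀)
    hw₀.stronglyMeasurable hη4 (lt_min hδ hε)
  obtain ⟨hgδ, hgε⟩ := lt_min_iff.1 hgδ
  replace hgδ := (Measure.le_add_right le_rfl _).trans_lt hgδ
  replace hgε := ((Measure.le_map_apply hy₀ _).trans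
    (Measure.le_add_left le_rfl _)).trans_lt hgε
  have hglim : TendstoInMeasure μ (fun n x => g (y n x)) atTop (fun x => g (y₀ x)) := by
    refine tendstoInMeasure_of_tendsto_ae
      (fun n => (hg.measurable.comp_aemeasurable (hy n)).aestronglyMeasurable) ?_
    filter_upwards [hlim] with x hx using (hg.tendsto _).comp hx
  have hwρ : TendstoInMeasure ρ w atTop w₀ :=
    tendstoInMeasure_of_tendsto_ae (fun n => (hw n).aestronglyMeasurable)
      (ae_restrict_of_ae hwlim)
  have hpull {n : ℕ} {u u' : E → F} (hu : Measurable u) (hu' : Measurable u')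
      (h : ρ {ξ | η / 4 ≤ edist (u ξ) (u' ξ)} < δ) :
      μ (y n ⁻¹' ({ξ | η / 4 ≤ edist (u ξ) (u' ξ)} ∩ B)) ≤ ε := by
    have hm : MeasurableSet {ξ | η / 4 ≤ edist (u ξ) (u' ξ)} :=
      measurableSet_le measurable_const (hu.edist hu')
    rw [hρ, Measure.restrict_apply hm] at h
    exact (Measure.le_map_apply (hy n) _).trans
      (hδε n _ (hm.inter hBK.isClosed.measurableSet) h).le
  filter_upwards [(hylim 1 one_pos).eventually_lt_const hε,
    (hglim _ hη4).eventually_lt_const hε, (hwρ _ hη4).eventually_lt_const hδ] with n h1 h2 h3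
  have h4 := hpull (n := n) (hw n) hw₀ h3
  have h5 := hpull (n := n) hg.measurable hw₀ hgδ
  refine le_trans ?_ hεε₀
  calc μ {x | η ≤ edist (w n (y n x)) (w₀ (y₀ x))}
      ≤ μ (((((y₀ ⁻¹' Kᶜ ∪ {x | 1 ≤ edist (y n x) (y₀ x)}) ∪
          {x | η / 4 ≤ edist (g (y n x)) (g (y₀ x))}) ∪
          y n ⁻¹' ({ξ | η / 4 ≤ edist (w n ξ) (w₀ ξ)} ∩ B)) ∪
          y n ⁻¹' ({ξ | η / 4 ≤ edist (g ξ) (w₀ ξ)} ∩ B)) ∪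
          y₀ ⁻¹' {ξ | η / 4 ≤ edist (g ξ) (w₀ ξ)}) := by
        refine measure_mono fun x hx => ?_
        by_contra h
        simp only [mem_union, mem_ofPred_eq, mem_preimage, mem_inter_iff, mem_compl_iff, not_or,
          not_le, not_and_or, not_not] at h hx
        obtain ⟨⟨⟨⟨⟨hK₀, hd⟩, hgg⟩, hww⟩, hgw⟩, hgw₀⟩ := h
        have hyB : y n x ∈ B := Metric.mem_cthickening_of_edist_le _ (y₀ x) _ _ hK₀
          (by simpa using hd.le)
        replace hww := hww.resolve_right (not_not_intro hyB)
        replace hgw := hgw.resolve_right (not_not_intro hyB)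
        rw [edist_comm] at hgw
        refine absurd hx (not_le.2 ?_)
        calc edist (w n (y n x)) (w₀ (y₀ x))
            ≤ edist (w n (y n x)) (w₀ (y n x)) + edist (w₀ (y n x)) (g (y n x)) +
                edist (g (y n x)) (g (y₀ x)) + edist (g (y₀ x)) (w₀ (y₀ x)) := by
              refine (edist_triangle _ (g (y₀ x)) _).trans (add_le_add_left ?_ _)
              exact edist_triangle4 _ _ _ _
          _ < η / 4 + η / 4 + η / 4 + η / 4 :=
            ENNReal.add_lt_add (ENNReal.add_lt_add (ENNReal.add_lt_add hww hgw) hgg) hgw₀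
          _ = η := by
            rw [← ENNReal.add_div, ← ENNReal.add_div, ← ENNReal.add_div,
              show η + η + η + η = η * 4 by ring]
            exact ENNReal.mul_div_cancel_right (by simp) (by simp)
    _ ≤ ((((ε + ε) + ε) + ε) + ε) + ε :=
        (measure_union_le _ _).trans (add_le_add ((measure_union_le _ _).trans (add_le_add
          ((measure_union_le _ _).trans (add_le_add ((measure_union_le _ _).trans (add_le_add
          ((measure_union_le _ _).trans (add_le_add hKε h1.le)) h2.le)) h4)) h5)) hgε.le)
    _ = 6 * ε := by ring

/-- If the integrals of the functions `u n` are uniformly small on sets of small volume, then they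
are bounded uniformly in `n` on bounded sets. -/
theorem exists_lintegral_le_of_equiIntegrable {ι F : Type*} [NormedAddCommGroup F] {N : ℕ}
    (hN : 0 < N) {Ω : Set (Euc N)} (hΩ : MeasurableSet Ω) (hΩb : Bornology.IsBounded Ω)
    {u : ι → Euc N → F}
    (hu : ∀ ε : ℝ≥0∞, 0 < ε → ∃ δ : ℝ≥0∞, 0 < δ ∧ ∀ n, ∀ S : Set (Euc N), S ⊆ Ω →
      MeasurableSet S → volume S < δ → (∫⁻ x in S, ‖u n x‖ₑ) < ε) :
    ∃ C : ℝ≥0, ∀ n, ∫⁻ x in Ω, ‖u n x‖ₑ ≤ C := by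
  have : Nonempty (Fin N) := ⟨⟨0, hN⟩⟩
  obtain ⟨δ, hδ, h⟩ := hu 1 one_pos
  have key : ∃ C : ℝ≥0, ∀ n, ∫⁻ x in closure Ω ∩ Ω, ‖u n x‖ₑ ≤ C := by
    refine hΩb.isCompact_closure.induction_on
      (p := fun s => ∃ C : ℝ≥0, ∀ n, ∫⁻ x in s ∩ Ω, ‖u n x‖ₑ ≤ C) ⟨0, by simp⟩ ?_ ?_ ?_
    · rintro s t hst ⟨C, hC⟩
      exact ⟨C, fun n => (lintegral_mono_set (inter_subset_inter_left _ hst)).trans (hC n)⟩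
    · rintro s t ⟨C, hC⟩ ⟨C', hC'⟩
      refine ⟨C + C', fun n => ?_⟩
      rw [union_inter_distrib_right, ENNReal.coe_add]
      exact (lintegral_union_le _ _ _).trans (add_le_add (hC n) (hC' n))
    · intro x _
      obtain ⟨U, hxU, hUo, hU⟩ := ({x} : Set (Euc N)).exists_isOpen_lt_of_lt (μ := volume) δ
        (by simpa using hδ)
      refine ⟨U, mem_nhdsWithin_of_mem_nhds (hUo.mem_nhds (hxU rfl)), 1, fun n => ?_⟩
      exact (h n _ inter_subset_right (hUo.measurableSet.inter hΩ)
        ((measure_mono inter_subset_left).trans_lt hU)).le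
  rwa [inter_eq_self_of_subset_right subset_closure] at key

/-- Equi-integrability on a bounded set, in the form of uniform integrability for the restricted
measure. -/
theorem uniformIntegrable_of_equiIntegrable {ι F : Type*} [NormedAddCommGroup F] {N : ℕ}
    (hN : 0 < N) {Ω : Set (Euc N)} (hΩ : MeasurableSet Ω) (hΩb : Bornology.IsBounded Ω)
    {u : ι → Euc N → F} (hum : ∀ n, AEStronglyMeasurable (u n) (volume.restrict Ω))
    (hu : ∀ ε : ℝ≥0∞, 0 < ε → ∃ δ : ℝ≥0∞, 0 < δ ∧ ∀ n, ∀ S : Set (Euc N), S ⊆ Ω →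
      MeasurableSet S → volume S < δ → (∫⁻ x in S, ‖u n x‖ₑ) < ε) :
    UniformIntegrable u 1 (volume.restrict Ω) := by
  refine ⟨hum, fun ε hε => ?_, ?_⟩
  · obtain ⟨δ, hδ, h⟩ := hu (ENNReal.ofReal ε) (ENNReal.ofReal_pos.2 hε)
    obtain ⟨r, hr, hrδ⟩ := ENNReal.lt_iff_exists_nnreal_btwn.1 hδ
    refine ⟨r, by simpa using hr, fun n s hs hsr => ?_⟩
    rw [Measure.restrict_apply hs, ENNReal.ofReal_coe_nnreal] at hsr
    rw [eLpNorm_indicator_eq_eLpNorm_restrict hs, Measure.restrict_restrict hs,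
      eLpNorm_one_eq_lintegral_enorm]
    exact (h n _ inter_subset_right (hs.inter hΩ) (hsr.trans_lt hrδ)).le
  · simpa only [eLpNorm_one_eq_lintegral_enorm] using
      exists_lintegral_le_of_equiIntegrable hN hΩ hΩb hu

namespace ApproxDiffTriple

variable {N : ℕ} {A D : Set (Euc N)} {u : Euc N → Euc N} {f : Euc N → Euc N →L[ℝ] Euc N}

theorem continuousOn (h : ApproxDiffTriple A D u f) : ContinuousOn u D :=
  fun x hx => (h.2.2.2 x hx).continuousWithinAt

theorem restrict_eq (h : ApproxDiffTriple A D u f) :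
    (volume : Measure (Euc N)).restrict A = volume.restrict D :=
  Measure.restrict_congr_set
    ((ae_le_set.2 h.2.2.1).antisymm (LE.le.eventuallyLE h.2.1))

theorem aemeasurable (h : ApproxDiffTriple A D u f) : AEMeasurable u (volume.restrict A) :=
  h.restrict_eq ▸ h.continuousOn.aemeasurable h.1

theorem measurableSet_image (h : ApproxDiffTriple A D u f) (hinj : InjOn u D) :
    MeasurableSet (u '' D) :=
  h.1.image_of_continuousOn_injOn h.continuousOn hinj

theorem comp_indicator_ae_eq {F : Type*} [Zero F] (h : ApproxDiffTriple A D u f) (v : Euc N → F) :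
    (fun x => (u '' D).indicator v (u x)) =ᵐ[volume.restrict A] fun x => v (u x) := by
  rw [h.restrict_eq]
  filter_upwards [ae_restrict_mem h.1] with x hx
  exact indicator_of_mem (mem_image_of_mem u hx) v

end ApproxDiffTriple

/-- Convergence of compositions: `v_n ∘ y_n → v ∘ y` in `L¹(Ω; ℝ^M)`. -/
theorem convergence_of_compositions {N M : ℕ} (hN : 2 ≤ N) (hM : 1 ≤ M)
    (Ω : Set (Euc N)) (hΩo : IsOpen Ω) (hΩb : Bornology.IsBounded Ω)
    (y : ℕ → Euc N → Euc N) (D : ℕ → Set (Euc N)) (f : ℕ → Euc N → Euc N →L[ℝ] Euc N)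
    (hadm : ∀ n, AdmissibleDef Ω (D n) (y n) (f n))
    (y₀ : Euc N → Euc N) (D₀ : Set (Euc N)) (f₀ : Euc N → Euc N →L[ℝ] Euc N)
    (hadm₀ : AdmissibleDef Ω D₀ y₀ f₀)
    (hae : ∀ᵐ x ∂(volume.restrict Ω), Tendsto (fun n => y n x) atTop (𝓝 (y₀ x)))
    (hdet : WeakL1ConvOn Ω (fun n x => (f n x).det) (fun x => (f₀ x).det))
    (hequi : ∀ ε : ℝ≥0∞, 0 < ε → ∃ δ : ℝ≥0∞, 0 < δ ∧ ∀ n, ∀ S : Set (Euc N),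
      MeasurableSet S → volume S < δ → volume (D n ∩ y n ⁻¹' S) < ε)
    (v : ℕ → Euc N → EuclideanSpace ℝ (Fin M)) (v₀ : Euc N → EuclideanSpace ℝ (Fin M))
    (hv : ∀ n, Measurable (v n)) (hv₀ : Measurable v₀)
    (hequiv : ∀ ε : ℝ≥0∞, 0 < ε → ∃ δ : ℝ≥0∞, 0 < δ ∧ ∀ n, ∀ S : Set (Euc N), S ⊆ Ω →
      MeasurableSet S → volume S < δ → (∫⁻ x in S, (‖v n (y n x)‖₊ : ℝ≥0∞)) < ε)
    (haev : ∀ᵐ ξ : Euc N, Tendsto (fun n => (y n '' D n).indicator (v n) ξ) atTop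
      (𝓝 ((y₀ '' D₀).indicator v₀ ξ))) :
    IntegrableOn (fun x => v₀ (y₀ x)) Ω volume ∧
      Tendsto (fun n => ∫ x in Ω, ‖v n (y n x) - v₀ (y₀ x)‖) atTop (𝓝 0) := by
  have : IsFiniteMeasure ((volume : Measure (Euc N)).restrict Ω) :=
    isFiniteMeasure_restrict.2 hΩb.measure_lt_top.ne
  have hmeas (n : ℕ) := (hadm n).1.aemeasurable
  have hconv : TendstoInMeasure (volume.restrict Ω) (fun n x => v n (y n x)) atTop
      (fun x => v₀ (y₀ x)) := by
    refine TendstoInMeasure.congr (fun n => (hadm n).1.comp_indicator_ae_eq (v n))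
      (hadm₀.1.comp_indicator_ae_eq v₀) ?_
    refine tendstoInMeasure_comp_of_tendsto_ae (ν := volume) hmeas hae (fun ε hε => ?_)
      (fun n => (hv n).indicator ((hadm n).1.measurableSet_image (hadm n).2.1))
      (hv₀.indicator (hadm₀.1.measurableSet_image hadm₀.2.1)) haev
    obtain ⟨δ, hδ, h⟩ := hequi ε hε
    refine ⟨δ, hδ, fun n S hS hSδ => ?_⟩
    rw [Measure.map_apply_of_aemeasurable (hmeas n) hS, (hadm n).1.restrict_eq,
      Measure.restrict_apply' (hadm n).1.1, inter_comm]
    exact h n S hS hSδ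
  have hvy (n : ℕ) : AEStronglyMeasurable (fun x => v n (y n x)) (volume.restrict Ω) :=
    ((hv n).comp_aemeasurable (hmeas n)).aestronglyMeasurable
  have hui : UniformIntegrable (fun n x => v n (y n x)) 1 (volume.restrict Ω) :=
    uniformIntegrable_of_equiIntegrable (by lia) hΩo.measurableSet hΩb hvy hequiv
  have hmem := hui.memLp_of_tendstoInMeasure hconv
  refine ⟨memLp_one_iff_integrable.1 hmem, ?_⟩
  have hlim := (ENNReal.tendsto_toReal ENNReal.zero_ne_top).comp
    (tendsto_Lp_finite_of_tendstoInMeasure le_rfl ENNReal.one_ne_top hvy hmem hui.2.1 hconv)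
  refine hlim.congr fun n => ?_
  rw [Function.comp_apply, eLpNorm_one_eq_lintegral_enorm]
  exact (integral_norm_eq_lintegral_enorm ((hvy n).sub hmem.1)).symm
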